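/- Let R be a 2-dimensional regular local ring containing ℂ with residue field ℂ, with maximal ideal m, A = R[t]/(t²), and I = (t) ⊆ A. Fix x, y ∈ A whose images x₀, y₀ in R generate m, and let 𝕁 be the set of ideals J ⊆ A admitting generators u, v with (u₀, v₀) = m. Then 𝕁 = {(x+Ā, y+B̄) : Ā, B̄ ∈ I}, and the map 𝕁 → mI/m²I sending the ideal (x+Ā, y+B̄) to the class of −y₀Ā + x₀B̄ in mI/m²I is a well-defined bijection. -/

import Mathlib

open Polynomial

noncomputable section

/-- The primitive multiple ring `R[n] = R[t]/(t^n)`. -/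
abbrev Rn (R : Type*) [CommRing R] (n : ℕ) : Type _ :=
  Polynomial R ⧸ Ideal.span {(X : Polynomial R) ^ n}

/-- The class `t` of the variable in `R[n]`. -/
def tn (R : Type*) [CommRing R] (n : ℕ) : Rn R n :=
  Ideal.Quotient.mk _ X

/-- `R[k] = R[n]/(t^k)` as an `R[n]`-module (for `k ≤ n` this is `R[t]/(t^k)`
with the `R[n]`-module structure coming from the natural surjection `R[n] → R[k]`). -/
abbrev Rmod (R : Type*) [CommRing R] (n k : ℕ) : Type _ :=
  Rn R n ⧸ (Ideal.span {tn R n ^ k})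

/-- The constant term homomorphism `R[n] → R` (for `n > 0`). -/
def ct (R : Type*) [CommRing R] (n : ℕ) (hn : 0 < n) : Rn R n →+* R :=
  Ideal.Quotient.lift _ (evalRingHom 0) (by
    intro a ha
    rw [Ideal.mem_span_singleton] at ha
    obtain ⟨c, rfl⟩ := ha
    simp [zero_pow hn.ne'])

section Modules

variable (R : Type*) [CommRing R] (n : ℕ) (M : Type*) [AddCommGroup M] [Module (Rn R n) M]

/-- The submodule `M_i = t^i M` of an `R[n]`-module `M`. -/
def tMi (i : ℕ) : Submodule (Rn R n) M :=
  LinearMap.range (LinearMap.lsmul (Rn R n) M (tn R n ^ i))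

/-- The submodule `M^{(i)} = {m ∈ M : t^i m = 0}` of an `R[n]`-module `M`. -/
def kt (i : ℕ) : Submodule (Rn R n) M :=
  LinearMap.ker (LinearMap.lsmul (Rn R n) M (tn R n ^ i))

/-- `G_i(M) = t^i M / t^{i+1} M`. -/
abbrev Gi (i : ℕ) :=
  (tMi R n M i) ⧸ (Submodule.comap (tMi R n M i).subtype (tMi R n M (i + 1)))

/-- `G^{(i+1)}(M) = M^{(i+1)}/M^{(i)}` (note the shift by one in the indexing:
`Gup R n M i` is `G^{(i+1)}(M)`). -/
abbrev Gup (i : ℕ) :=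
  (kt R n M (i + 1)) ⧸ (Submodule.comap (kt R n M (i + 1)).subtype (kt R n M i))

lemma tMi_succ_mem {i : ℕ} {x : M} (hx : x ∈ tMi R n M i) :
    tn R n • x ∈ tMi R n M (i + 1) := by
  obtain ⟨m, rfl⟩ := hx
  exact ⟨m, by simp [LinearMap.lsmul_apply, smul_smul, pow_succ']⟩

lemma kt_pred_mem {i : ℕ} {x : M} (hx : x ∈ kt R n M (i + 1)) :
    tn R n • x ∈ kt R n M i := by
  simp only [kt, LinearMap.mem_ker, LinearMap.lsmul_apply] at hx ⊢
  rw [smul_smul, ← pow_succ]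
  exact hx

/-- `μ_i : G_i(M) → G_{i+1}(M)`, induced by multiplication by `t`. -/
def muMap (i : ℕ) : Gi R n M i →ₗ[Rn R n] Gi R n M (i + 1) :=
  Submodule.mapQ _ _
    (LinearMap.restrict (LinearMap.lsmul (Rn R n) M (tn R n))
      (fun _ hx => tMi_succ_mem R n M hx))
    (fun x hx => by
      simp only [Submodule.mem_comap] at hx ⊢
      exact tMi_succ_mem R n M hx)

/-- `λ_{i+1} : G^{(i+2)}(M) → G^{(i+1)}(M)`, induced by multiplication by `t`
(with the shifted indexing, `lamMap R n M i : Gup (i+1) → Gup i`). -/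
def lamMap (i : ℕ) : Gup R n M (i + 1) →ₗ[Rn R n] Gup R n M i :=
  Submodule.mapQ _ _
    (LinearMap.restrict (LinearMap.lsmul (Rn R n) M (tn R n))
      (fun _ hx => kt_pred_mem R n M hx))
    (fun x hx => by
      simp only [Submodule.mem_comap] at hx ⊢
      exact kt_pred_mem R n M hx)

/-- The composition `μ_{k-1} ∘ ... ∘ μ_0 : G_0(M) → G_k(M)`. -/
def muComp : (k : ℕ) → (Gi R n M 0 →ₗ[Rn R n] Gi R n M k)
  | 0 => LinearMap.id
  | (k + 1) => (muMap R n M k).comp (muComp k)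

/-- The composition `λ_1 ∘ ... ∘ λ_k : G^{(k+1)}(M) → G^{(1)}(M)`. -/
def lamComp : (k : ℕ) → (Gup R n M k →ₗ[Rn R n] Gup R n M 0)
  | 0 => LinearMap.id
  | (k + 1) => (lamComp k).comp (lamMap R n M k)

end Modules

section DoubleLocal

/-- The constant term homomorphism `A = R[2] → R`. -/
def ct2 (R : Type*) [CommRing R] : Rn R 2 →+* R := ct R 2 (by norm_num)

/-- The ideal `I = (t) ⊆ A = R[2]` (the ideal of `X ⊆ X₂` at the point). -/
def It (R : Type*) [CommRing R] : Ideal (Rn R 2) := Ideal.span {tn R 2}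

/-- The ideal `𝔪I ⊆ A = R[2]`. -/
def mIt (R : Type*) [CommRing R] [IsLocalRing R] : Ideal (Rn R 2) :=
  Ideal.map (algebraMap R (Rn R 2)) (IsLocalRing.maximalIdeal R) * It R

/-- The ideal `𝔪²I ⊆ A = R[2]`. -/
def m2It (R : Type*) [CommRing R] [IsLocalRing R] : Ideal (Rn R 2) :=
  (Ideal.map (algebraMap R (Rn R 2)) (IsLocalRing.maximalIdeal R)) ^ 2 * It R

end DoubleLocal

section DoubleStructure

variable {R : Type*} [CommRing R]

lemma tn_two_mul_self : tn R 2 * tn R 2 = 0 := by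
  rw [tn, ← map_mul, Ideal.Quotient.eq_zero_iff_mem, ← pow_two]
  exact Ideal.mem_span_singleton_self _

lemma ct2_tn : ct2 R (tn R 2) = 0 := by
  simp [ct2, ct, tn]

lemma ct2_algebraMap (a : R) : ct2 R (algebraMap R (Rn R 2) a) = a :=
  (Ideal.Quotient.lift_mk _ _ _).trans eval_C

lemma exists_eq_algebraMap_add (z : Rn R 2) :
    ∃ b : R, z = algebraMap R _ (ct2 R z) + algebraMap R _ b * tn R 2 := by
  obtain ⟨p, rfl⟩ := Ideal.Quotient.mk_surjective z
  refine ⟨p.divX.coeff 0, ?_⟩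
  have hp : p = C (p.coeff 0) + C (p.divX.coeff 0) * X + p.divX.divX * X ^ 2 := by
    conv_lhs => rw [← p.divX_mul_X_add, ← p.divX.divX_mul_X_add]
    ring
  have h0 : ct2 R (Ideal.Quotient.mk _ p) = p.coeff 0 := by
    simp [ct2, ct, coeff_zero_eq_eval_zero]
  rw [h0]
  change _ = Ideal.Quotient.mk _ (C (p.coeff 0)) + Ideal.Quotient.mk _ (C (p.divX.coeff 0)) *
    Ideal.Quotient.mk _ X
  rw [← map_mul, ← map_add, Ideal.Quotient.eq, Ideal.mem_span_singleton]
  exact ⟨p.divX.divX, by linear_combination hp⟩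

lemma algebraMap_mul_tn_injective :
    Function.Injective fun a : R ↦ algebraMap R (Rn R 2) a * tn R 2 := by
  intro a b h
  have h' : Ideal.Quotient.mk (Ideal.span {(X : R[X]) ^ 2}) (C a * X) =
      Ideal.Quotient.mk _ (C b * X) := by
    rw [map_mul, map_mul]
    exact h
  rw [Ideal.Quotient.eq, Ideal.mem_span_singleton, X_pow_dvd_iff] at h'
  simpa [sub_eq_zero] using h' 1 one_lt_two

lemma mem_It_iff {z : Rn R 2} : z ∈ It R ↔ ∃ a : R, z = algebraMap R _ a * tn R 2 := by
  rw [It, Ideal.mem_span_singleton']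
  constructor
  · rintro ⟨c, rfl⟩
    obtain ⟨d, hd⟩ := exists_eq_algebraMap_add c
    refine ⟨ct2 R c, ?_⟩
    linear_combination tn R 2 * hd + algebraMap R _ d * tn_two_mul_self (R := R)
  · rintro ⟨a, rfl⟩
    exact ⟨_, rfl⟩

lemma ct2_eq_zero_of_mem_It {z : Rn R 2} (hz : z ∈ It R) : ct2 R z = 0 := by
  obtain ⟨a, rfl⟩ := mem_It_iff.1 hz
  rw [map_mul, ct2_tn, mul_zero]

lemma mem_It_of_ct2_eq_zero {z : Rn R 2} (hz : ct2 R z = 0) : z ∈ It R := by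
  obtain ⟨b, hb⟩ := exists_eq_algebraMap_add z
  rw [hz, map_zero, zero_add] at hb
  exact mem_It_iff.2 ⟨b, hb⟩

lemma mem_map_mul_It_iff {𝔞 : Ideal R} {z : Rn R 2} :
    z ∈ 𝔞.map (algebraMap R (Rn R 2)) * It R ↔ ∃ a ∈ 𝔞, z = algebraMap R _ a * tn R 2 := by
  rw [It, Ideal.mem_mul_span_singleton]
  constructor
  · rintro ⟨w, hw, rfl⟩
    obtain ⟨d, hd⟩ := exists_eq_algebraMap_add w
    refine ⟨ct2 R w, ?_, ?_⟩
    · have hle : 𝔞.map (algebraMap R (Rn R 2)) ≤ 𝔞.comap (ct2 R) :=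
        Ideal.map_le_iff_le_comap.2 fun a ha ↦ by
          rwa [Ideal.mem_comap, Ideal.mem_comap, ct2_algebraMap]
      exact hle hw
    · linear_combination tn R 2 * hd + algebraMap R _ d * tn_two_mul_self (R := R)
  · rintro ⟨a, ha, rfl⟩
    exact ⟨_, Ideal.mem_map_of_mem _ ha, rfl⟩

variable [IsLocalRing R]

lemma algebraMap_mul_tn_mem_mIt {a : R} :
    algebraMap R _ a * tn R 2 ∈ mIt R ↔ a ∈ IsLocalRing.maximalIdeal R := by
  rw [mIt, mem_map_mul_It_iff]
  exact ⟨fun ⟨b, hb, h⟩ ↦ algebraMap_mul_tn_injective h ▸ hb, fun h ↦ ⟨a, h, rfl⟩⟩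

lemma algebraMap_mul_tn_mem_m2It {a : R} :
    algebraMap R _ a * tn R 2 ∈ m2It R ↔ a ∈ IsLocalRing.maximalIdeal R ^ 2 := by
  rw [m2It, ← Ideal.map_pow, mem_map_mul_It_iff]
  exact ⟨fun ⟨b, hb, h⟩ ↦ algebraMap_mul_tn_injective h ▸ hb, fun h ↦ ⟨a, h, rfl⟩⟩

lemma maximalIdeal_eq_span_ct2_add {x y A B : Rn R 2}
    (hxy : IsLocalRing.maximalIdeal R = Ideal.span {ct2 R x, ct2 R y})
    (hA : A ∈ It R) (hB : B ∈ It R) :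
    IsLocalRing.maximalIdeal R = Ideal.span {ct2 R (x + A), ct2 R (y + B)} := by
  rwa [map_add, map_add, ct2_eq_zero_of_mem_It hA, ct2_eq_zero_of_mem_It hB, add_zero, add_zero]

end DoubleStructure

section RegularParameters

open IsLocalRing

variable {R : Type*} [CommRing R] [IsLocalRing R] [IsNoetherianRing R]

/-- Two generators of the maximal ideal of a 2-dimensional Noetherian local ring are linearly
independent modulo the square of the maximal ideal. -/
lemma left_coeff_mem_maximalIdeal (hdim : ringKrullDim R = 2) {p q c d : R}
    (hpq : maximalIdeal R = Ideal.span {p, q}) (h : c * p + d * q ∈ maximalIdeal R ^ 2) :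
    c ∈ maximalIdeal R := by
  by_contra hc
  obtain ⟨e, he⟩ := (notMem_maximalIdeal.1 hc).exists_right_inv
  have hq : Ideal.span {q} ≤ maximalIdeal R := by
    rw [hpq]
    exact Ideal.span_mono (by simp)
  have hle : maximalIdeal R ≤ Ideal.span {q} ⊔ maximalIdeal R • maximalIdeal R := by
    rw [smul_eq_mul, ← pow_two]
    conv_lhs => rw [hpq]
    rw [Ideal.span_le, Set.pair_subset_iff]
    have hqm : q ∈ Ideal.span {q} ⊔ maximalIdeal R ^ 2 :=
      Ideal.mem_sup_left (Ideal.mem_span_singleton_self q)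
    refine ⟨?_, hqm⟩
    have : p = e * (c * p + d * q) - e * d * q := by linear_combination -p * he
    rw [this]
    exact sub_mem (Ideal.mul_mem_left _ _ (Ideal.mem_sup_right h)) (Ideal.mul_mem_left _ _ hqm)
  have hm : maximalIdeal R = Ideal.span {q} :=
    le_antisymm (Submodule.le_of_le_smul_of_le_jacobson_bot (IsNoetherian.noetherian _)
      (maximalIdeal_le_jacobson _) hle) hq
  have hht : (maximalIdeal R).height ≤ 1 := by
    refine Ideal.height_le_one_of_isPrincipal_of_mem_minimalPrimes (Ideal.span {q}) _ ?_
    rw [← hm, Ideal.minimalPrimes_eq_subsingleton_self]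
    rfl
  have := maximalIdeal_height_eq_ringKrullDim (R := R)
  rw [hdim] at this
  have h2 : (maximalIdeal R).height = 2 := WithBot.coe_injective this
  rw [h2] at hht
  exact absurd hht (by decide)

lemma coeffs_mem_maximalIdeal (hdim : ringKrullDim R = 2) {p q c d : R}
    (hpq : maximalIdeal R = Ideal.span {p, q}) (h : c * p + d * q ∈ maximalIdeal R ^ 2) :
    c ∈ maximalIdeal R ∧ d ∈ maximalIdeal R :=
  ⟨left_coeff_mem_maximalIdeal hdim hpq h,
    left_coeff_mem_maximalIdeal hdim (by rwa [Set.pair_comm]) (by rwa [add_comm])⟩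

lemma mem_maximalIdeal_sq_iff (hdim : ringKrullDim R = 2) {p q c d : R}
    (hpq : maximalIdeal R = Ideal.span {p, q}) :
    c * p + d * q ∈ maximalIdeal R ^ 2 ↔ c ∈ maximalIdeal R ∧ d ∈ maximalIdeal R := by
  refine ⟨coeffs_mem_maximalIdeal hdim hpq, fun ⟨hc, hd⟩ ↦ ?_⟩
  have hp : p ∈ maximalIdeal R := hpq ▸ Ideal.subset_span (by simp)
  have hq : q ∈ maximalIdeal R := hpq ▸ Ideal.subset_span (by simp)
  rw [pow_two]
  exact add_mem (Ideal.mul_mem_mul hc hp) (Ideal.mul_mem_mul hd hq)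

/-- The change-of-basis matrix between two pairs of generators of the maximal ideal of a
2-dimensional Noetherian local ring is invertible. -/
lemma exists_isUnit_det (hdim : ringKrullDim R = 2) {p q u v : R}
    (hpq : maximalIdeal R = Ideal.span {p, q}) (huv : maximalIdeal R = Ideal.span {u, v}) :
    ∃ a b c d : R, a * u + b * v = p ∧ c * u + d * v = q ∧ IsUnit (a * d - b * c) := by
  have hp : p ∈ Ideal.span {u, v} := huv ▸ hpq ▸ Ideal.subset_span (by simp)
  have hq : q ∈ Ideal.span {u, v} := huv ▸ hpq ▸ Ideal.subset_span (by simp)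
  have hu : u ∈ Ideal.span {p, q} := hpq ▸ huv ▸ Ideal.subset_span (by simp)
  have hv : v ∈ Ideal.span {p, q} := hpq ▸ huv ▸ Ideal.subset_span (by simp)
  obtain ⟨a, b, hab⟩ := Ideal.mem_span_pair.1 hp
  obtain ⟨c, d, hcd⟩ := Ideal.mem_span_pair.1 hq
  obtain ⟨a', b', hab'⟩ := Ideal.mem_span_pair.1 hu
  obtain ⟨c', d', hcd'⟩ := Ideal.mem_span_pair.1 hv
  refine ⟨a, b, c, d, hab, hcd, ?_⟩
  obtain ⟨h₁, h₂⟩ := coeffs_mem_maximalIdeal hdim hpq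
    (c := a * a' + b * c' - 1) (d := a * b' + b * d') (by
      convert zero_mem (maximalIdeal R ^ 2) using 1
      linear_combination a * hab' + b * hcd' + hab)
  obtain ⟨h₃, h₄⟩ := coeffs_mem_maximalIdeal hdim hpq
    (c := c * a' + d * c') (d := c * b' + d * d' - 1) (by
      convert zero_mem (maximalIdeal R ^ 2) using 1
      linear_combination c * hab' + d * hcd' + hcd)
  rw [← notMem_maximalIdeal]
  intro hdet
  refine (Ideal.ne_top_iff_one _).1 (maximalIdeal.isMaximal R).ne_top ?_
  have : (1 : R) = (a' * d' - b' * c') * (a * d - b * c)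
      - (c * b' + d * d') * (a * a' + b * c' - 1) - (c * b' + d * d' - 1)
      + (c * a' + d * c') * (a * b' + b * d') := by ring
  rw [this]
  exact add_mem (sub_mem (sub_mem (Ideal.mul_mem_left _ _ hdet) (Ideal.mul_mem_left _ _ h₁)) h₄)
    (Ideal.mul_mem_left _ _ h₂)

/-- If the constant terms of `u, v` generate `𝔪`, then `(u, v) ∩ I = 𝔪I`. -/
lemma algebraMap_mul_tn_mem_span_pair (hdim : ringKrullDim R = 2) {u v : Rn R 2}
    (huv : maximalIdeal R = Ideal.span {ct2 R u, ct2 R v}) {a : R} :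
    algebraMap R _ a * tn R 2 ∈ Ideal.span {u, v} ↔ a ∈ maximalIdeal R := by
  obtain ⟨u₁, hu⟩ := exists_eq_algebraMap_add u
  obtain ⟨v₁, hv⟩ := exists_eq_algebraMap_add v
  have ht := tn_two_mul_self (R := R)
  rw [Ideal.mem_span_pair]
  constructor
  · rintro ⟨c, d, h⟩
    obtain ⟨c₁, hc⟩ := exists_eq_algebraMap_add c
    obtain ⟨d₁, hd⟩ := exists_eq_algebraMap_add d
    have h₀ : ct2 R c * ct2 R u + ct2 R d * ct2 R v = 0 := by
      simpa [ct2_tn] using congrArg (ct2 R) h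
    obtain ⟨hc₀, hd₀⟩ := coeffs_mem_maximalIdeal hdim huv (h₀ ▸ zero_mem _)
    have ha : a = c₁ * ct2 R u + d₁ * ct2 R v + ct2 R c * u₁ + ct2 R d * v₁ := by
      apply algebraMap_mul_tn_injective
      have h₀' := congrArg (algebraMap R (Rn R 2)) h₀
      simp only [map_add, map_mul, map_zero] at h₀' ⊢
      generalize ct2 R u = u₀ at *
      generalize ct2 R v = v₀ at *
      generalize ct2 R c = c₀ at *
      generalize ct2 R d = d₀ at *
      subst hu hv hc hd
      linear_combination -h + h₀' + (algebraMap R _ c₁ * algebraMap R _ u₁ +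
        algebraMap R _ d₁ * algebraMap R _ v₁) * ht
    have hu₀ : ct2 R u ∈ maximalIdeal R := huv ▸ Ideal.subset_span (by simp)
    have hv₀ : ct2 R v ∈ maximalIdeal R := huv ▸ Ideal.subset_span (by simp)
    rw [ha]
    exact add_mem (add_mem (add_mem (Ideal.mul_mem_left _ _ hu₀) (Ideal.mul_mem_left _ _ hv₀))
      (Ideal.mul_mem_right _ _ hc₀)) (Ideal.mul_mem_right _ _ hd₀)
  · intro ha
    rw [huv, Ideal.mem_span_pair] at ha
    obtain ⟨c, d, rfl⟩ := ha
    refine ⟨algebraMap R _ c * tn R 2, algebraMap R _ d * tn R 2, ?_⟩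
    rw [map_add, map_mul, map_mul]
    linear_combination algebraMap R _ c * tn R 2 * hu + algebraMap R _ d * tn R 2 * hv +
      (algebraMap R _ c * algebraMap R _ u₁ + algebraMap R _ d * algebraMap R _ v₁) * ht

lemma exists_span_pair_eq (hdim : ringKrullDim R = 2) {x y u v : Rn R 2}
    (hxy : maximalIdeal R = Ideal.span {ct2 R x, ct2 R y})
    (huv : maximalIdeal R = Ideal.span {ct2 R u, ct2 R v}) :
    ∃ A B : Rn R 2, A ∈ It R ∧ B ∈ It R ∧ Ideal.span {u, v} = Ideal.span {x + A, y + B} := by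
  obtain ⟨a, b, c, d, hab, hcd, hdet⟩ := exists_isUnit_det hdim hxy huv
  let ι := algebraMap R (Rn R 2)
  refine ⟨ι a * u + ι b * v - x, ι c * u + ι d * v - y, ?_, ?_, ?_⟩
  · apply mem_It_of_ct2_eq_zero
    simp [ι, ct2_algebraMap, hab]
  · apply mem_It_of_ct2_eq_zero
    simp [ι, ct2_algebraMap, hcd]
  · rw [add_sub_cancel, add_sub_cancel]
    obtain ⟨e, he⟩ := hdet.exists_right_inv
    have he' : (ι a * ι d - ι b * ι c) * ι e = 1 := by
      rw [← map_mul, ← map_mul, ← map_sub, ← map_mul, he, map_one]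
    apply le_antisymm
    · rw [Ideal.span_le, Set.pair_subset_iff]
      constructor
      · exact Ideal.mem_span_pair.2 ⟨ι e * ι d, -(ι e * ι b), by linear_combination u * he'⟩
      · exact Ideal.mem_span_pair.2 ⟨-(ι e * ι c), ι e * ι a, by linear_combination v * he'⟩
    · rw [Ideal.span_le, Set.pair_subset_iff]
      exact ⟨Ideal.mem_span_pair.2 ⟨_, _, rfl⟩, Ideal.mem_span_pair.2 ⟨_, _, rfl⟩⟩

lemma span_pair_le_of_sub_mem (hdim : ringKrullDim R = 2) {x y : Rn R 2}
    (hxy : maximalIdeal R = Ideal.span {ct2 R x, ct2 R y}) {a b a' b' : R}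
    (ha : a' - a ∈ maximalIdeal R) (hb : b' - b ∈ maximalIdeal R) :
    Ideal.span {x + algebraMap R _ a' * tn R 2, y + algebraMap R _ b' * tn R 2} ≤
      Ideal.span {x + algebraMap R _ a * tn R 2, y + algebraMap R _ b * tn R 2} := by
  have hJ := maximalIdeal_eq_span_ct2_add hxy (mem_It_iff.2 ⟨a, rfl⟩) (mem_It_iff.2 ⟨b, rfl⟩)
  rw [← algebraMap_mul_tn_mem_span_pair hdim hJ, map_sub] at ha hb
  rw [Ideal.span_le, Set.pair_subset_iff]
  have hu : x + algebraMap R _ a * tn R 2 ∈ Ideal.span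
      {x + algebraMap R _ a * tn R 2, y + algebraMap R _ b * tn R 2} :=
    Ideal.subset_span (Set.mem_insert _ _)
  have hv : y + algebraMap R _ b * tn R 2 ∈ Ideal.span
      {x + algebraMap R _ a * tn R 2, y + algebraMap R _ b * tn R 2} :=
    Ideal.subset_span (Set.mem_insert_of_mem _ (Set.mem_singleton _))
  refine ⟨?_, ?_⟩ <;> rw [SetLike.mem_coe]
  · convert add_mem hu ha using 1
    ring
  · convert add_mem hv hb using 1
    ring

lemma span_pair_eq_iff (hdim : ringKrullDim R = 2) {x y : Rn R 2}
    (hxy : maximalIdeal R = Ideal.span {ct2 R x, ct2 R y}) {a b a' b' : R} :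
    Ideal.span {x + algebraMap R _ a' * tn R 2, y + algebraMap R _ b' * tn R 2} =
      Ideal.span {x + algebraMap R _ a * tn R 2, y + algebraMap R _ b * tn R 2} ↔
    a' - a ∈ maximalIdeal R ∧ b' - b ∈ maximalIdeal R := by
  constructor
  · intro h
    have hJ := maximalIdeal_eq_span_ct2_add hxy (mem_It_iff.2 ⟨a, rfl⟩) (mem_It_iff.2 ⟨b, rfl⟩)
    have hu : x + algebraMap R _ a * tn R 2 ∈ Ideal.span
        {x + algebraMap R _ a * tn R 2, y + algebraMap R _ b * tn R 2} :=
      Ideal.subset_span (Set.mem_insert _ _)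
    have hv : y + algebraMap R _ b * tn R 2 ∈ Ideal.span
        {x + algebraMap R _ a * tn R 2, y + algebraMap R _ b * tn R 2} :=
      Ideal.subset_span (Set.mem_insert_of_mem _ (Set.mem_singleton _))
    have hle := h.le
    rw [Ideal.span_le, Set.pair_subset_iff] at hle
    rw [← algebraMap_mul_tn_mem_span_pair hdim hJ, ← algebraMap_mul_tn_mem_span_pair hdim hJ]
    constructor
    · convert sub_mem hle.1 hu using 1
      rw [map_sub]
      ring
    · convert sub_mem hle.2 hv using 1
      rw [map_sub]
      ring
  · rintro ⟨ha, hb⟩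
    exact le_antisymm (span_pair_le_of_sub_mem hdim hxy ha hb)
      (span_pair_le_of_sub_mem hdim hxy (by simpa using neg_mem ha) (by simpa using neg_mem hb))

end RegularParameters

/-- Let `R` be a 2-dimensional regular local ring containing `ℂ` with residue field `ℂ`,
with maximal ideal `𝔪`, `A = R[t]/(t²)` and `I = (t)`. Fix `x, y ∈ A` whose images
`x₀, y₀` in `R` generate `𝔪`, and let `𝕁` be the set of ideals of `A` admitting two
generators whose images in `R` generate `𝔪`. Then `𝕁 = {(x+Ā, y+B̄) : Ā, B̄ ∈ I}`, and
the map `𝕁 → 𝔪I/𝔪²I` sending `(x+Ā, y+B̄)` to the class of `-y₀Ā + x₀B̄` is a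
well-defined bijection. -/
theorem ideals_parametrized_by_quotient
    {R : Type*} [CommRing R] [IsLocalRing R] [IsNoetherianRing R] [Algebra ℂ R]
    (hdim : ringKrullDim R = 2)
    (hreg : ∃ a b : R, IsLocalRing.maximalIdeal R = Ideal.span {a, b})
    (hres : ∀ r : R, ∃ c : ℂ, r - algebraMap ℂ R c ∈ IsLocalRing.maximalIdeal R)
    (x y : Rn R 2)
    (hxy : IsLocalRing.maximalIdeal R = Ideal.span {ct2 R x, ct2 R y}) :
    ({J : Ideal (Rn R 2) | ∃ u v : Rn R 2, J = Ideal.span {u, v} ∧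
        IsLocalRing.maximalIdeal R = Ideal.span {ct2 R u, ct2 R v}} =
      {J : Ideal (Rn R 2) | ∃ A B : Rn R 2, A ∈ It R ∧ B ∈ It R ∧
        J = Ideal.span {x + A, y + B}}) ∧
    (∃ f : {J : Ideal (Rn R 2) // ∃ u v : Rn R 2, J = Ideal.span {u, v} ∧
              IsLocalRing.maximalIdeal R = Ideal.span {ct2 R u, ct2 R v}} →
            (↥(mIt R) ⧸ Submodule.comap (mIt R).subtype (m2It R)),
      Function.Bijective f ∧
      ∀ (A B : Rn R 2), A ∈ It R → B ∈ It R →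
        ∀ (h : ∃ u v : Rn R 2, Ideal.span {x + A, y + B} = Ideal.span {u, v} ∧
            IsLocalRing.maximalIdeal R = Ideal.span {ct2 R u, ct2 R v})
          (hz : -(algebraMap R (Rn R 2) (ct2 R y)) * A
              + algebraMap R (Rn R 2) (ct2 R x) * B ∈ mIt R),
          f ⟨Ideal.span {x + A, y + B}, h⟩ =
            Submodule.Quotient.mk
              (⟨-(algebraMap R (Rn R 2) (ct2 R y)) * A
                  + algebraMap R (Rn R 2) (ct2 R x) * B, hz⟩ : ↥(mIt R))) := by
  have hsets : ∀ J : Ideal (Rn R 2), (∃ u v : Rn R 2, J = Ideal.span {u, v} ∧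
      IsLocalRing.maximalIdeal R = Ideal.span {ct2 R u, ct2 R v}) ↔
      ∃ A B : Rn R 2, A ∈ It R ∧ B ∈ It R ∧ J = Ideal.span {x + A, y + B} := by
    intro J
    constructor
    · rintro ⟨u, v, rfl, huv⟩
      exact exists_span_pair_eq hdim hxy huv
    · rintro ⟨A, B, hA, hB, rfl⟩
      exact ⟨_, _, rfl, maximalIdeal_eq_span_ct2_add hxy hA hB⟩
  refine ⟨Set.ext hsets, ?_⟩
  have hcoords : ∀ J : {J : Ideal (Rn R 2) // ∃ u v : Rn R 2, J = Ideal.span {u, v} ∧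
      IsLocalRing.maximalIdeal R = Ideal.span {ct2 R u, ct2 R v}}, ∃ a b : R,
      J.1 = Ideal.span {x + algebraMap R _ a * tn R 2, y + algebraMap R _ b * tn R 2} := by
    rintro ⟨J, hJ⟩
    obtain ⟨A, B, hA, hB, rfl⟩ := (hsets J).1 hJ
    obtain ⟨a, rfl⟩ := mem_It_iff.1 hA
    obtain ⟨b, rfl⟩ := mem_It_iff.1 hB
    exact ⟨a, b, rfl⟩
  choose α β hαβ using hcoords
  have hx₀ : ct2 R x ∈ IsLocalRing.maximalIdeal R := hxy ▸ Ideal.subset_span (by simp)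
  have hy₀ : ct2 R y ∈ IsLocalRing.maximalIdeal R := hxy ▸ Ideal.subset_span (by simp)
  let g (a b : R) : mIt R := ⟨algebraMap R _ (b * ct2 R x + -a * ct2 R y) * tn R 2,
    algebraMap_mul_tn_mem_mIt.2
      (add_mem (Ideal.mul_mem_left _ _ hx₀) (Ideal.mul_mem_left _ _ hy₀))⟩
  have hg : ∀ a b a' b' : R,
      (Submodule.Quotient.mk (g a' b') : ↥(mIt R) ⧸ Submodule.comap (mIt R).subtype (m2It R)) =
        Submodule.Quotient.mk (g a b) ↔
      Ideal.span {x + algebraMap R _ a' * tn R 2, y + algebraMap R _ b' * tn R 2} =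
        Ideal.span {x + algebraMap R _ a * tn R 2, y + algebraMap R _ b * tn R 2} := by
    intro a b a' b'
    have hsub : (mIt R).subtype (g a' b' - g a b) =
        algebraMap R _ ((b' - b) * ct2 R x + (a - a') * ct2 R y) * tn R 2 := by
      simp only [g, map_sub, map_add, map_mul, map_neg, Submodule.subtype_apply]
      ring
    rw [Submodule.Quotient.eq, Submodule.mem_comap, hsub, algebraMap_mul_tn_mem_m2It,
      mem_maximalIdeal_sq_iff hdim hxy, span_pair_eq_iff hdim hxy, and_comm, ← neg_sub a' a,
      neg_mem_iff]
  refine ⟨fun J ↦ Submodule.Quotient.mk (g (α J) (β J)), ⟨?_, ?_⟩, ?_⟩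
  · intro J J' h
    rw [hg, ← hαβ, ← hαβ] at h
    exact Subtype.ext h
  · intro q
    obtain ⟨⟨z, hz⟩, rfl⟩ := Submodule.Quotient.mk_surjective _ q
    obtain ⟨c, hc, rfl⟩ := mem_map_mul_It_iff.1 hz
    rw [hxy, Ideal.mem_span_pair] at hc
    obtain ⟨b, a, rfl⟩ := hc
    refine ⟨⟨Ideal.span {x + algebraMap R _ (-a) * tn R 2, y + algebraMap R _ b * tn R 2},
      (hsets _).2 ⟨_, _, mem_It_iff.2 ⟨_, rfl⟩, mem_It_iff.2 ⟨_, rfl⟩, rfl⟩⟩, ?_⟩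
    refine ((hg (-a) b _ _).2 (hαβ _).symm).trans (congrArg _ (Subtype.ext ?_))
    simp only [g, neg_neg]
  · intro A B hA hB h hz
    obtain ⟨a, rfl⟩ := mem_It_iff.1 hA
    obtain ⟨b, rfl⟩ := mem_It_iff.1 hB
    refine ((hg a b _ _).2 (hαβ _).symm).trans (congrArg _ (Subtype.ext ?_))
    simp only [g, map_add, map_mul, map_neg]
    ring
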